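/- Let T = {(2,7,8),(2,7,9),(3,4,5),(3,4,8),(3,6,8),(3,7,8),(3,7,9),(4,6,7),(4,6,8),(4,6,9),(4,7,8),(4,7,9),(5,6,7),(5,6,8),(5,6,9),(5,7,8),(5,7,9),(5,8,9),(6,7,8),(6,7,9)}. There do not exist nine points p₁,…,p₉ ∈ ℝ², no three of them collinear, such that for all 1 ≤ i < j < k ≤ 9 one has det(p_j − p_i, p_k − p_i) > 0 if and only if (i,j,k) ∈ T. (That is, the abstract order type of the non-Pappus pseudo-line arrangement in standard labeling is not realizable by a point set in the Euclidean plane.) -/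

import Mathlib

open scoped RealInnerProductSpace ENNReal Classical

noncomputable section

/-- Points of the Euclidean plane. -/
abbrev Pt : Type := EuclideanSpace ℝ (Fin 2)

/-- The planar determinant `det (u, v)` of two vectors. -/
def det2 (u v : Pt) : ℝ := u 0 * v 1 - u 1 * v 0

/-- No three of the points of `S` are collinear. -/
def NoThreeCollinear (S : Set Pt) : Prop :=
  ∀ p ∈ S, ∀ q ∈ S, ∀ r ∈ S, p ≠ q → p ≠ r → q ≠ r → det2 (q - p) (r - p) ≠ 0

/-- `S` is in strong general position: no three points are collinear and for any four
distinct points `p₁ p₂ p₃ p₄` the line through `p₁,p₂` is not parallel to the line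
through `p₃,p₄`. -/
def StrongGenPos (S : Set Pt) : Prop :=
  NoThreeCollinear S ∧
    ∀ p₁ ∈ S, ∀ p₂ ∈ S, ∀ p₃ ∈ S, ∀ p₄ ∈ S,
      p₁ ≠ p₂ → p₁ ≠ p₃ → p₁ ≠ p₄ → p₂ ≠ p₃ → p₂ ≠ p₄ → p₃ ≠ p₄ →
        det2 (p₂ - p₁) (p₄ - p₃) ≠ 0

/-- A simple polygon, given by a cyclic sequence of `n ≥ 3` distinct vertices
(encoded as an `n`-periodic function `ℕ → Pt`), such that no point of the plane lies on
more than two closed edges, and the only points lying on exactly two edges are vertices. -/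
structure SimplePolygon where
  n : ℕ
  three_le : 3 ≤ n
  vtx : ℕ → Pt
  periodic : ∀ i, vtx (i + n) = vtx i
  inj : ∀ i < n, ∀ j < n, vtx i = vtx j → i = j
  simple : ∀ x : Pt, {i | i < n ∧ x ∈ segment ℝ (vtx i) (vtx (i + 1))}.ncard ≤ 2
  vtx_of_two : ∀ x : Pt,
    {i | i < n ∧ x ∈ segment ℝ (vtx i) (vtx (i + 1))}.ncard = 2 → ∃ i < n, x = vtx i

namespace SimplePolygon

/-- The boundary of a simple polygon: the union of its closed edges. -/
def boundary (P : SimplePolygon) : Set Pt :=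
  ⋃ i ∈ Finset.range P.n, segment ℝ (P.vtx i) (P.vtx (i + 1))

/-- The interior of a simple polygon: the union of the bounded connected components of the
complement of the boundary. -/
def interior (P : SimplePolygon) : Set Pt :=
  {x | x ∉ P.boundary ∧ Bornology.IsBounded (connectedComponentIn P.boundaryᶜ x)}

/-- A simple polygon, regarded as a point set: boundary together with interior. -/
def region (P : SimplePolygon) : Set Pt := P.boundary ∪ P.interior

/-- The set of vertices of the polygon. -/
def vertexSet (P : SimplePolygon) : Set Pt := {x | ∃ i < P.n, x = P.vtx i}

/-- Twice the shoelace signed area. -/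
def shoelace (P : SimplePolygon) : ℝ := ∑ i ∈ Finset.range P.n, det2 (P.vtx i) (P.vtx (i + 1))

/-- The vertices are listed in counterclockwise order (positive shoelace signed area). -/
def CCW (P : SimplePolygon) : Prop := 0 < P.shoelace

/-- The vertex `vtx (i+1)` is a convex vertex:
`det (v_{i+1} − v_i, v_{i+2} − v_{i+1}) > 0` (vertices listed counterclockwise). -/
def ConvexAt (P : SimplePolygon) (i : ℕ) : Prop :=
  0 < det2 (P.vtx (i + 1) - P.vtx i) (P.vtx (i + 2) - P.vtx (i + 1))

/-- The number of convex vertices of the polygon. -/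
def numConvex (P : SimplePolygon) : ℕ := {i | i < P.n ∧ P.ConvexAt i}.ncard

/-- Continuous paths from `s` to `t` staying inside the polygon. -/
def pathsIn (P : SimplePolygon) (s t : Pt) : Set (ℝ → Pt) :=
  {γ | ContinuousOn γ (Set.Icc 0 1) ∧ γ 0 = s ∧ γ 1 = t ∧ γ '' Set.Icc (0 : ℝ) 1 ⊆ P.region}

/-- The geodesic distance between `s` and `t` inside the polygon: the infimum of the
lengths (total variations) of continuous paths in the polygon from `s` to `t`. -/
def geodDist (P : SimplePolygon) (s t : Pt) : ℝ≥0∞ :=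
  ⨅ γ ∈ P.pathsIn s t, eVariationOn γ (Set.Icc 0 1)

end SimplePolygon

/-- Length of a polygonal path through a list of points. -/
def polylineLen : List Pt → ℝ
  | [] => 0
  | [_] => 0
  | a :: b :: l => dist a b + polylineLen (b :: l)

/-- The polygonal path through a list of points, as a point set. -/
def polylineSet : List Pt → Set Pt
  | [] => ∅
  | [a] => {a}
  | a :: b :: l => segment ℝ a b ∪ polylineSet (b :: l)

/-- `L` is the vertex sequence of the geodesic from `s` to `t` inside the polygon `P`:
a polygonal path inside `P` from `s` to `t`, with consecutive vertices distinct, with no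
three consecutive vertices collinear, whose length realizes the geodesic distance. -/
def SimplePolygon.IsGeodesicChain (P : SimplePolygon) (s t : Pt) (L : List Pt) : Prop :=
  L.head? = some s ∧ L.getLast? = some t ∧ List.Chain' (· ≠ ·) L ∧
  (∀ i, i + 2 < L.length →
      det2 (L.getD (i + 1) 0 - L.getD i 0) (L.getD (i + 2) 0 - L.getD i 0) ≠ 0) ∧
  polylineSet L ⊆ P.region ∧
  ENNReal.ofReal (polylineLen L) = P.geodDist s t

/-- The triple `(p,q,r)` is in geodesic counterclockwise order with respect to `P`:
writing the geodesics `π(p,q) = ⟨p = v₀, …, v_k = q⟩` and `π(p,r) = ⟨p = u₀, …, u_{k'} = r⟩`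
and taking the smallest index `i > 0` with `v_i ≠ u_i`, we have
`det (v_i − v_{i−1}, u_i − v_{i−1}) > 0`. -/
def geodesicCCW (P : SimplePolygon) (p q r : Pt) : Prop :=
  ∃ L M : List Pt, P.IsGeodesicChain p q L ∧ P.IsGeodesicChain p r M ∧
    ∃ i : ℕ, 0 < i ∧ (∀ j < i, L[j]? = M[j]?) ∧ L[i]? ≠ M[i]? ∧
      ∃ a b c : Pt, L[i - 1]? = some a ∧ L[i]? = some b ∧ M[i]? = some c ∧
        0 < det2 (b - a) (c - a)

/-- The triple `(p,q,r)` is in geodesic clockwise order with respect to `P`. -/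
def geodesicCW (P : SimplePolygon) (p q r : Pt) : Prop :=
  ∃ L M : List Pt, P.IsGeodesicChain p q L ∧ P.IsGeodesicChain p r M ∧
    ∃ i : ℕ, 0 < i ∧ (∀ j < i, L[j]? = M[j]?) ∧ L[i]? ≠ M[i]? ∧
      ∃ a b c : Pt, L[i - 1]? = some a ∧ L[i]? = some b ∧ M[i]? = some c ∧
        det2 (b - a) (c - a) < 0

/-- `C ⊆ P` is geodesically convex: for all `p, q ∈ C` the geodesic connecting them
stays inside `C`. -/
def GeodesicallyConvex (P : SimplePolygon) (C : Set Pt) : Prop :=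
  C ⊆ P.region ∧ ∀ p ∈ C, ∀ q ∈ C, ∀ L, P.IsGeodesicChain p q L → polylineSet L ⊆ C

/-- The geodesic hull `CH_P(U)`: the intersection of all geodesically convex subsets of `P`
containing `U`. -/
def geodesicHull (P : SimplePolygon) (U : Set Pt) : Set Pt :=
  ⋂₀ {C | GeodesicallyConvex P C ∧ U ⊆ C}

/-- `E_P(S)`: the set of points of `S` lying on the (topological) boundary of the geodesic
hull of `S` with respect to `P`. -/
def extremeSet (P : SimplePolygon) (S : Set Pt) : Set Pt :=
  {x ∈ S | x ∈ frontier (geodesicHull P S)}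

/-- `B` is separable from `R`: there is a simple polygon with at most `|B|` convex vertices
whose interior contains all points of `R` and which contains no point of `B`. -/
def Separable (B R : Finset Pt) : Prop :=
  ∃ P : SimplePolygon, P.CCW ∧ P.numConvex ≤ B.card ∧
    (∀ r ∈ R, r ∈ P.interior) ∧ ∀ b ∈ B, b ∉ P.region

/-- The ascending counterclockwise triples of the non-Pappus abstract order type
(standard labeling). -/
def nonPappusCCW : Set (ℕ × ℕ × ℕ) :=
  {(2,7,8),(2,7,9),(3,4,5),(3,4,8),(3,6,8),(3,7,8),(3,7,9),(4,6,7),(4,6,8),(4,6,9),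
   (4,7,8),(4,7,9),(5,6,7),(5,6,8),(5,6,9),(5,7,8),(5,7,9),(5,8,9),(6,7,8),(6,7,9)}

/-- The orientation determinant of the points of `p` with indices `i`, `j`, `k`. -/
def tripleDet (p : ℕ → Pt) (i j k : ℕ) : ℝ := det2 (p j - p i) (p k - p i)

theorem tripleDet_eq (p : ℕ → Pt) (i j k : ℕ) :
    tripleDet p i j k =
      (p j 0 - p i 0) * (p k 1 - p i 1) - (p j 1 - p i 1) * (p k 0 - p i 0) := rfl

theorem tripleDet_swap (p : ℕ → Pt) (i j k : ℕ) : tripleDet p j i k = -tripleDet p i j k := by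
  simp only [tripleDet_eq]
  ring

set_option maxHeartbeats 1000000 in
/-- The non-Pappus abstract order type is not realizable by a point set
in the Euclidean plane. -/
theorem nonPappus_not_realizable_in_plane :
    ¬ ∃ p : ℕ → Pt,
      (∀ i, 1 ≤ i → i ≤ 9 → ∀ j, 1 ≤ j → j ≤ 9 → p i = p j → i = j) ∧
      (∀ i j k : ℕ, 1 ≤ i → i ≤ 9 → 1 ≤ j → j ≤ 9 → 1 ≤ k → k ≤ 9 →
        i ≠ j → i ≠ k → j ≠ k → det2 (p j - p i) (p k - p i) ≠ 0) ∧
      ∀ i j k : ℕ, 1 ≤ i → i < j → j < k → k ≤ 9 →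
        (0 < det2 (p j - p i) (p k - p i) ↔ (i, j, k) ∈ nonPappusCCW) := by
  rintro ⟨p, -, hne, hp⟩
  have pos (i j k : ℕ) (h : (i, j, k) ∈ nonPappusCCW := by simp [nonPappusCCW])
      (hb : 1 ≤ i ∧ i < j ∧ j < k ∧ k ≤ 9 := by decide) : 0 < tripleDet p i j k :=
    (hp i j k hb.1 hb.2.1 hb.2.2.1 hb.2.2.2).2 h
  have neg (i j k : ℕ) (h : (i, j, k) ∉ nonPappusCCW := by simp [nonPappusCCW])
      (hb : 1 ≤ i ∧ i < j ∧ j < k ∧ k ≤ 9 := by decide) : 0 < tripleDet p j i k := by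
    obtain ⟨hi, hij, hjk, hk⟩ := hb
    rw [tripleDet_swap, neg_pos]
    refine lt_of_le_of_ne (not_lt.1 fun hlt => h ((hp i j k hi hij hjk hk).1 hlt)) ?_
    exact hne i j k (by omega) (by omega) (by omega) (by omega) (by omega) hk
      (by omega) (by omega) (by omega)
  -- A biquadratic final polynomial: the product of the nine three-term Grassmann–Plücker
  -- inequalities below has the same brackets on both sides.
  have h12369 : tripleDet p 2 1 9 * tripleDet p 3 1 6 <
      tripleDet p 2 1 6 * tripleDet p 3 1 9 := by
    have h := mul_pos (neg 1 2 3) (neg 1 6 9)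
    simp only [tripleDet_eq] at h ⊢
    linear_combination h
  have h14789 : tripleDet p 4 1 7 * tripleDet p 8 7 9 <
      tripleDet p 7 1 9 * tripleDet p 4 7 8 := by
    have h := mul_pos (neg 1 7 8) (pos 4 7 9)
    simp only [tripleDet_eq] at h ⊢
    linear_combination h
  have h12456 : tripleDet p 2 1 6 * tripleDet p 5 4 6 <
      tripleDet p 4 1 6 * tripleDet p 5 2 6 := by
    have h := mul_pos (neg 1 5 6) (neg 2 4 6)
    simp only [tripleDet_eq] at h ⊢
    linear_combination h
  have h13469 : tripleDet p 3 1 9 * tripleDet p 4 3 6 <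
      tripleDet p 3 1 6 * tripleDet p 4 3 9 := by
    have h := mul_pos (neg 1 3 4) (neg 3 6 9)
    simp only [tripleDet_eq] at h ⊢
    linear_combination h
  have h24589 : tripleDet p 5 2 9 * tripleDet p 8 4 9 <
      tripleDet p 8 2 9 * tripleDet p 5 4 9 := by
    have h := mul_pos (neg 2 4 9) (pos 5 8 9)
    simp only [tripleDet_eq] at h ⊢
    linear_combination h
  have h13467 : tripleDet p 4 1 6 * tripleDet p 4 3 7 <
      tripleDet p 4 1 7 * tripleDet p 4 3 6 := by
    have h := mul_pos (neg 1 3 4) (pos 4 6 7)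
    simp only [tripleDet_eq] at h ⊢
    linear_combination h
  have h24569 : tripleDet p 5 2 6 * tripleDet p 5 4 9 <
      tripleDet p 5 2 9 * tripleDet p 5 4 6 := by
    have h := mul_pos (neg 2 4 5) (pos 5 6 9)
    simp only [tripleDet_eq] at h ⊢
    linear_combination h
  have h34789 : tripleDet p 4 3 9 * tripleDet p 4 7 8 <
      tripleDet p 4 3 7 * tripleDet p 8 4 9 := by
    have h := mul_pos (pos 3 4 8) (pos 4 7 9)
    simp only [tripleDet_eq] at h ⊢
    linear_combination h
  have h12789 : tripleDet p 7 1 9 * tripleDet p 8 2 9 <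
      tripleDet p 2 1 9 * tripleDet p 8 7 9 := by
    have h := mul_pos (neg 1 8 9) (pos 2 7 9)
    simp only [tripleDet_eq] at h ⊢
    linear_combination h
  have d126 := neg 1 2 6
  have d129 := neg 1 2 9
  have d136 := neg 1 3 6
  have d139 := neg 1 3 9
  have d146 := neg 1 4 6
  have d147 := neg 1 4 7
  have d179 := neg 1 7 9
  have d256 := neg 2 5 6
  have d259 := neg 2 5 9
  have d289 := neg 2 8 9
  have d346 := neg 3 4 6
  have d347 := neg 3 4 7
  have d349 := neg 3 4 9
  have d456 := neg 4 5 6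
  have d459 := neg 4 5 9
  have d478 := pos 4 7 8
  have d489 := neg 4 8 9
  have d789 := neg 7 8 9
  have m1 := mul_lt_mul'' h12369 h14789 (by positivity) (by positivity)
  have m2 := mul_lt_mul'' m1 h12456 (by positivity) (by positivity)
  have m3 := mul_lt_mul'' m2 h13469 (by positivity) (by positivity)
  have m4 := mul_lt_mul'' m3 h24589 (by positivity) (by positivity)
  have m5 := mul_lt_mul'' m4 h13467 (by positivity) (by positivity)
  have m6 := mul_lt_mul'' m5 h24569 (by positivity) (by positivity)
  have m7 := mul_lt_mul'' m6 h34789 (by positivity) (by positivity)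
  have m8 := mul_lt_mul'' m7 h12789 (by positivity) (by positivity)
  exact m8.ne (by ring)
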